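/- Let (p,p') be a pair of coprime positive integers with p ≥ 2 and p' ≥ 2, set a = p'/p, let (r,s) ∈ K_{p,p'}, x ∈ ℂ, and ε,ε' ∈ {0,1}. Then for all (τ,u,t) ∈ ℍ×ℂ×ℂ one has T^{ε,ε'}_{r,s;x}(−1/τ, u/τ, t − u²/(6τ)) = Σ_{(r',s')∈K_{p,p'}} ∫_ℝ S^{tt,(ε,ε')}_{(r,s;x),(r',s';x')} · T^{ε',ε}_{r',s';x'}(τ,u,t) dx', where S^{tt,(ε,ε')}_{(r,s;x),(r',s';x')} = i^{−εε'} S_{(r,s),(r',s')} √(2a) e^{−4πia(x−iε/2)(x'−iε'/2)} and the integral converges absolutely. -/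

import Mathlib

open Complex MeasureTheory
open scoped Real

noncomputable section

/-- `e2 x = exp(2πi x)`. -/
def e2 (x : ℂ) : ℂ := Complex.exp (2 * (π : ℂ) * Complex.I * x)

/-- Dedekind dedekindEta function. -/
def dedekindEta (τ : ℂ) : ℂ := e2 (τ / 24) * ∏' n : ℕ, (1 - e2 (τ * (n + 1)))

/-- Jacobi theta with characteristics ε, ε' ∈ {0,1}. -/
def theta (ε ε' : ℕ) (u τ : ℂ) : ℂ :=
  e2 (u * ε / 2) * e2 (τ * ε / 8) *
    ∏' n : ℕ,
      ((1 - e2 (τ * (n + 1))) *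
        (1 + (-1 : ℂ) ^ ε' * e2 u * e2 (τ * ((n + 1 : ℂ) - (1 - (ε : ℂ)) / 2))) *
        (1 + (-1 : ℂ) ^ ε' * e2 (-u) * e2 (τ * ((n + 1 : ℂ) - (1 + (ε : ℂ)) / 2))))

/-- Normalized BPZ minimal-series character. -/
def chiBPZ (p p' r s : ℤ) (τ : ℂ) : ℂ :=
  (dedekindEta τ)⁻¹ * ∑' n : ℤ,
    (e2 (τ * ((p * p' : ℂ) * ((n : ℂ) + ((r * p' - s * p : ℤ) : ℂ) / (2 * p * p')) ^ 2)) -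
     e2 (τ * ((p * p' : ℂ) * ((n : ℂ) + ((-r * p' - s * p : ℤ) : ℂ) / (2 * p * p')) ^ 2)))

/-- The typical character function T^{ε,ε'}_{r,s;x}(τ,u,t). -/
def Tchar (p p' : ℤ) (ε ε' : ℕ) (r s : ℤ) (x : ℂ) (τ u t : ℂ) : ℂ :=
  (-1 : ℂ) ^ (ε * ε') *
    e2 (τ * (((p' : ℂ) / p) * (x - Complex.I * ε / 2) ^ 2)) *
    e2 (u * (2 * Complex.I * ((p' : ℂ) / p) * (x - Complex.I * ε / 2))) *
    e2 (t * (3 * (1 - 2 * ((p' : ℂ) / p)))) *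
    theta ε ε' u τ / (dedekindEta τ) ^ 2 * chiBPZ p p' r s τ

/-- The index set K_{p,p'}. -/
def Kset (p p' : ℤ) : Finset (ℤ × ℤ) :=
  (Finset.Icc 1 (p - 1) ×ˢ Finset.Icc 1 (p' - 1)).filter
    (fun rs => rs.1 * p' + rs.2 * p ≤ p * p')

/-- BPZ modular S-matrix. -/
def SBPZ (p p' r s r' s' : ℤ) : ℂ :=
  (Real.sqrt (8 / ((p : ℝ) * p')) : ℂ) * (-1 : ℂ) ^ ((r + s) * (r' + s')) *
    (Real.sin (π * ((p : ℝ) - p') * r * r' / p) : ℂ) *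
    (Real.sin (π * ((p : ℝ) - p') * s * s' / p') : ℂ)

/-- Typical-typical modular S-data. -/
def Stt (p p' : ℤ) (ε ε' : ℕ) (r s : ℤ) (x : ℂ) (r' s' : ℤ) (x' : ℂ) : ℂ :=
  Complex.I ^ (-((ε : ℤ) * ε')) * SBPZ p p' r s r' s' *
    (Real.sqrt (2 * ((p' : ℝ) / p)) : ℂ) *
    Complex.exp (-4 * (π : ℂ) * Complex.I * ((p' : ℂ) / p) *
      (x - Complex.I * ε / 2) * (x' - Complex.I * ε' / 2))

/-- The Gaussian binomial coefficients, through the `q`-Pascal recursion. -/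
def gaussBinom (q : ℂ) : ℕ → ℕ → ℂ
  | _, 0 => 1
  | 0, _ + 1 => 0
  | M + 1, j + 1 => gaussBinom q M j + q ^ (j + 1) * gaussBinom q M (j + 1)

/-- The finite `q`-Pochhammer symbol `(q; q)_n`. -/
def qPoch (q : ℂ) (n : ℕ) : ℂ := ∏ i ∈ Finset.range n, (1 - q ^ (i + 1))

lemma gaussBinom_zero_right (q : ℂ) (M : ℕ) : gaussBinom q M 0 = 1 := by
  cases M <;> simp [gaussBinom]

lemma gaussBinom_eq_zero_of_lt (q : ℂ) {M j : ℕ} (h : M < j) : gaussBinom q M j = 0 := by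
  induction M generalizing j with
  | zero => obtain ⟨j, rfl⟩ := Nat.exists_eq_succ_of_ne_zero h.ne'; simp [gaussBinom]
  | succ M ih =>
    obtain ⟨j, rfl⟩ := Nat.exists_eq_succ_of_ne_zero (Nat.ne_of_gt (Nat.zero_lt_of_lt h))
    simp [gaussBinom, ih (show M < j by omega), ih (show M < j + 1 by omega)]

lemma gaussBinom_mul_qPoch (q : ℂ) (a b : ℕ) :
    gaussBinom q (a + b) a * (qPoch q a * qPoch q b) = qPoch q (a + b) := by
  obtain ⟨M, hM⟩ : ∃ M, a + b = M := ⟨_, rfl⟩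
  induction M generalizing a b with
  | zero =>
    obtain ⟨rfl, rfl⟩ : a = 0 ∧ b = 0 := by omega
    simp [gaussBinom, qPoch]
  | succ M ih =>
    rcases a with _ | a
    · simp [gaussBinom_zero_right, qPoch]
    have hs (n : ℕ) : qPoch q (n + 1) = qPoch q n * (1 - q ^ (n + 1)) := by
      simp [qPoch, Finset.prod_range_succ]
    have h1 := ih a b (by omega)
    rw [show a + 1 + b = (a + b) + 1 by omega, gaussBinom, hs (a + b), hs a]
    rcases b with _ | b
    · rw [gaussBinom_eq_zero_of_lt q (show a + 0 < a + 1 by omega)]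
      linear_combination (1 - q ^ (a + 1)) * h1
    · have h2 := ih (a + 1) b (by omega)
      rw [show a + 1 + b = a + (b + 1) by omega, hs a] at h2
      rw [hs b] at h1 ⊢
      have : q ^ (a + (b + 1) + 1) = q ^ (a + 1) * q ^ (b + 1) := by ring
      linear_combination (1 - q ^ (a + 1)) * h1 + q ^ (a + 1) * (1 - q ^ (b + 1)) * h2 +
        qPoch q (a + (b + 1)) * this

lemma prod_one_add_eq_sum_gaussBinom (h : ℂ) (N : ℕ) (y : ℂ) :
    ∏ n ∈ Finset.range N, (1 + y * h ^ (2 * n + 1)) =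
      ∑ j ∈ Finset.range (N + 1), gaussBinom (h ^ 2) N j * (y ^ j * h ^ (j ^ 2)) := by
  induction N generalizing y with
  | zero => simp [gaussBinom]
  | succ N ih =>
    rw [Finset.prod_range_succ']
    have : ∏ n ∈ Finset.range N, (1 + y * h ^ (2 * (n + 1) + 1)) =
        ∏ n ∈ Finset.range N, (1 + (y * h ^ 2) * h ^ (2 * n + 1)) :=
      Finset.prod_congr rfl fun n _ => by ring
    rw [this, ih, Finset.sum_range_succ' _ (N + 1)]
    simp only [gaussBinom]
    have e1 := Finset.sum_range_succ' (fun j => gaussBinom (h ^ 2) N j *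
      ((y * h ^ 2) ^ j * h ^ (j ^ 2))) (N + 1)
    rw [Finset.sum_range_succ, gaussBinom_eq_zero_of_lt _ (Nat.lt_succ_self N)] at e1
    simp only [zero_mul, add_zero] at e1
    rw [mul_add, mul_one]
    conv_lhs => enter [1]; rw [e1]
    rw [Finset.sum_mul]
    simp only [gaussBinom_zero_right, add_mul, Finset.sum_add_distrib]
    have e2 : ∀ j : ℕ, gaussBinom (h ^ 2) N j * ((y * h ^ 2) ^ j * h ^ j ^ 2) *
        (y * h ^ (2 * 0 + 1)) =  gaussBinom (h ^ 2) N j * (y ^ (j + 1) * h ^ (j + 1) ^ 2) :=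
      fun j => by ring
    have e3 : ∀ j : ℕ, gaussBinom (h ^ 2) N (j + 1) * ((y * h ^ 2) ^ (j + 1) * h ^ (j + 1) ^ 2) =
        (h ^ 2) ^ (j + 1) * gaussBinom (h ^ 2) N (j + 1) * (y ^ (j + 1) * h ^ (j + 1) ^ 2) :=
      fun j => by ring
    simp only [e2, e3]
    ring

lemma finite_triple_product {h : ℂ} (hh : h ≠ 0) (M N : ℕ) {y : ℂ} (hy : y ≠ 0) :
    (∏ n ∈ Finset.range N, (1 + y * h ^ (2 * n + 1))) *
        ∏ n ∈ Finset.range M, (1 + y⁻¹ * h ^ (2 * n + 1)) =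
      ∑ j ∈ Finset.range (M + N + 1), gaussBinom (h ^ 2) (M + N) j *
        (y ^ ((j : ℤ) - M) * h ^ (((j : ℤ) - M) ^ 2)) := by
  induction M generalizing N y with
  | zero =>
    simp only [Finset.range_zero, Finset.prod_empty, mul_one, zero_add,
      prod_one_add_eq_sum_gaussBinom]
    refine Finset.sum_congr rfl fun j _ => ?_
    simp only [Nat.cast_zero, sub_zero, zpow_natCast]
    rw [← zpow_natCast h (j ^ 2)]; push_cast; rfl
  | succ M ih =>
    have hy' : y * (h ^ 2)⁻¹ ≠ 0 := by positivity
    have := ih (N + 1) hy'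
    rw [Finset.prod_range_succ'] at this
    rw [Finset.prod_range_succ', show M + 1 + N = M + (N + 1) by omega]
    have e1 : ∀ n : ℕ, y * (h ^ 2)⁻¹ * h ^ (2 * (n + 1) + 1) = y * h ^ (2 * n + 1) :=
      fun n => by field_simp; ring
    have e2 : ∀ n : ℕ, (y * (h ^ 2)⁻¹)⁻¹ * h ^ (2 * n + 1) = y⁻¹ * h ^ (2 * (n + 1) + 1) :=
      fun n => by field_simp; ring
    simp only [e1, e2] at this
    calc _ = y⁻¹ * h * (((∏ n ∈ Finset.range N, (1 + y * h ^ (2 * n + 1))) *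
          (1 + y * (h ^ 2)⁻¹ * h ^ (2 * 0 + 1))) *
          ∏ n ∈ Finset.range M, (1 + y⁻¹ * h ^ (2 * (n + 1) + 1))) := by
            field_simp; ring
      _ = _ := by
        rw [this, Finset.mul_sum]
        refine Finset.sum_congr rfl fun j _ => ?_
        push_cast
        rw [show ((j : ℤ) - (M + 1)) = (j - M) - 1 by ring]
        generalize (j : ℤ) - M = k
        rw [show (k - 1) ^ 2 = k ^ 2 + (-2 * k + 1) by ring, zpow_add₀ hh, zpow_add₀ hh, mul_zpow,
          zpow_sub₀ hy, zpow_mul, zpow_one, zpow_one, inv_zpow, zpow_neg, inv_zpow]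
        norm_cast
        ring

open Filter Topology in
lemma tendsto_qPoch {q : ℂ} (hq : ‖q‖ < 1) :
    Tendsto (qPoch q) atTop (𝓝 (∏' n : ℕ, (1 - q ^ (n + 1)))) :=
  (ModularForm.multipliable_one_sub_pow hq).hasProd.tendsto_prod_nat

lemma one_sub_pow_succ_ne_zero {q : ℂ} (hq : ‖q‖ < 1) (n : ℕ) : 1 - q ^ (n + 1) ≠ 0 := by
  intro h
  have : ‖q ^ (n + 1)‖ < 1 := by
    rw [norm_pow]; exact pow_lt_one₀ (norm_nonneg _) hq (by omega)
  rw [← sub_eq_zero.mp h] at this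
  simp at this

lemma tprod_one_sub_pow_ne_zero {q : ℂ} (hq : ‖q‖ < 1) : ∏' n : ℕ, (1 - q ^ (n + 1)) ≠ 0 := by
  simp only [sub_eq_add_neg]
  refine tprod_one_add_ne_zero_of_summable (f := fun n : ℕ => -q ^ (n + 1)) ?_ ?_
  · intro n; simpa [sub_eq_add_neg] using one_sub_pow_succ_ne_zero hq n
  · simpa using (summable_nat_add_iff 1).mpr (summable_geometric_of_lt_one (norm_nonneg _) hq)

lemma qPoch_ne_zero {q : ℂ} (hq : ‖q‖ < 1) (n : ℕ) : qPoch q n ≠ 0 :=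
  Finset.prod_ne_zero_iff.mpr fun i _ => one_sub_pow_succ_ne_zero hq i

lemma gaussBinom_eq_div {q : ℂ} (hq : ‖q‖ < 1) (a b : ℕ) :
    gaussBinom q (a + b) a = qPoch q (a + b) * (qPoch q a)⁻¹ * (qPoch q b)⁻¹ := by
  have := gaussBinom_mul_qPoch q a b
  have h1 := qPoch_ne_zero hq a
  have h2 := qPoch_ne_zero hq b
  field_simp
  linear_combination this

lemma exists_norm_gaussBinom_le {q : ℂ} (hq : ‖q‖ < 1) :
    ∃ C : ℝ, 0 ≤ C ∧ ∀ M j, ‖gaussBinom q M j‖ ≤ C := by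
  obtain ⟨A, hA⟩ := (Metric.isBounded_range_of_tendsto _ (tendsto_qPoch hq)).exists_norm_le
  obtain ⟨B, hB⟩ := (Metric.isBounded_range_of_tendsto _
    ((tendsto_qPoch hq).inv₀ (tprod_one_sub_pow_ne_zero hq))).exists_norm_le
  have hA' (n : ℕ) : ‖qPoch q n‖ ≤ A := hA _ ⟨n, rfl⟩
  have hB' (n : ℕ) : ‖(qPoch q n)⁻¹‖ ≤ B := hB _ ⟨n, rfl⟩
  have hA0 := (norm_nonneg _).trans (hA' 0)
  have hB0 := (norm_nonneg _).trans (hB' 0)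
  refine ⟨A * B * B, by positivity, fun M j => ?_⟩
  rcases lt_or_ge M j with h | h
  · rw [gaussBinom_eq_zero_of_lt q h, norm_zero]; positivity
  · obtain ⟨b, rfl⟩ := Nat.exists_eq_add_of_le h
    rw [gaussBinom_eq_div hq, norm_mul, norm_mul]
    gcongr <;> first | exact hA' _ | exact hB' _

lemma finite_triple_product_symm {h : ℂ} (hh : h ≠ 0) (N : ℕ) {y : ℂ} (hy : y ≠ 0) :
    (∏ n ∈ Finset.range N, (1 + y * h ^ (2 * n + 1))) *
        ∏ n ∈ Finset.range N, (1 + y⁻¹ * h ^ (2 * n + 1)) =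
      ∑' k : ℤ, (if -(N : ℤ) ≤ k then gaussBinom (h ^ 2) (N + N) (k + N).toNat else 0) *
        (y ^ k * h ^ (k ^ 2)) := by
  rw [finite_triple_product hh N N hy, tsum_eq_sum (s := Finset.Icc (-(N : ℤ)) N)]
  · refine Finset.sum_nbij' (fun j => (j : ℤ) - N) (fun k => (k + N).toNat) ?_ ?_ ?_ ?_ ?_
    · intro j hj; simp at hj ⊢; omega
    · intro k hk; simp at hk ⊢; omega
    · intro j hj; simp
    · intro k hk; simp at hk ⊢; omega
    · intro j hj; simp
  · intro k hk
    split_ifs with h1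
    · rw [gaussBinom_eq_zero_of_lt, zero_mul]
      simp at hk; omega
    · simp

open Filter Topology in
theorem jacobi_triple_product (z τ : ℂ) (hτ : 0 < τ.im) :
    ∏' n : ℕ, ((1 - cexp (π * I * τ) ^ (2 * (n + 1))) *
        (1 + cexp (2 * π * I * z) * cexp (π * I * τ) ^ (2 * n + 1)) *
        (1 + cexp (2 * π * I * (-z)) * cexp (π * I * τ) ^ (2 * n + 1))) = jacobiTheta₂ z τ := by
  set h := cexp (π * I * τ) with hh
  set y := cexp (2 * π * I * z) with hy
  have hyinv : cexp (2 * π * I * (-z)) = y⁻¹ := by rw [hy, ← Complex.exp_neg]; ring_nf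
  rw [hyinv]
  have hh0 : h ≠ 0 := Complex.exp_ne_zero _
  have hy0 : y ≠ 0 := Complex.exp_ne_zero _
  have hn : ‖h‖ < 1 := by
    rw [hh, Complex.norm_exp, Real.exp_lt_one_iff]
    simp
    positivity
  have hq : ‖h ^ 2‖ < 1 := by rw [norm_pow]; exact pow_lt_one₀ (norm_nonneg _) hn (by omega)
  have hterm (k : ℤ) : y ^ k * h ^ (k ^ 2) = jacobiTheta₂_term k z τ := by
    rw [hy, hh, ← Complex.exp_int_mul, ← Complex.exp_int_mul, ← Complex.exp_add,
      jacobiTheta₂_term]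
    push_cast; ring_nf
  have hsum := ((summable_jacobiTheta₂_term_iff z τ).mpr hτ).norm
  set Q := ∏' n : ℕ, (1 - (h ^ 2) ^ (n + 1)) with hQ
  have hQ0 : Q ≠ 0 := tprod_one_sub_pow_ne_zero hq
  have hodd : Summable fun n : ℕ => ‖h ^ (2 * n + 1)‖ := by
    simp only [norm_pow]
    exact (summable_geometric_of_lt_one (norm_nonneg _) hn).comp_injective
      (fun a b hab => by simp at hab; omega)
  have hm1 : Multipliable fun n : ℕ => 1 - h ^ (2 * (n + 1)) := by
    simpa only [pow_mul] using ModularForm.multipliable_one_sub_pow hq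
  have hm (w : ℂ) : Multipliable fun n : ℕ => 1 + w * h ^ (2 * n + 1) :=
    multipliable_one_add_of_summable (by simpa only [norm_mul] using hodd.mul_left ‖w‖)
  have hlim := ((hm1.mul (hm y)).mul (hm y⁻¹)).hasProd.tendsto_prod_nat
  obtain ⟨C, hC0, hC⟩ := exists_norm_gaussBinom_le hq
  have hlim2 : Tendsto (fun N : ℕ => ∑' k : ℤ,
      (if -(N : ℤ) ≤ k then gaussBinom (h ^ 2) (N + N) (k + N).toNat else 0) *
        (y ^ k * h ^ (k ^ 2))) atTop (𝓝 (∑' k : ℤ, Q⁻¹ * jacobiTheta₂_term k z τ)) := by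
    refine tendsto_tsum_of_dominated_convergence (hsum.mul_left C) ?_ ?_
    · intro k
      simp only [hterm]
      refine Tendsto.mul_const _ ?_
      have hQl := tendsto_qPoch hq
      rw [← hQ] at hQl
      have hl : Tendsto (fun N : ℕ => qPoch (h ^ 2) (N + N) * (qPoch (h ^ 2) (k + N).toNat)⁻¹ *
          (qPoch (h ^ 2) (N - k).toNat)⁻¹) atTop (𝓝 (Q * Q⁻¹ * Q⁻¹)) := by
        refine ((hQl.comp ?_).mul ((hQl.comp ?_).inv₀ hQ0)).mul ((hQl.comp ?_).inv₀ hQ0)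
        · exact tendsto_atTop_mono (fun N => Nat.le_add_left N N) tendsto_id
        · refine tendsto_atTop.mpr fun b => ?_
          filter_upwards [eventually_ge_atTop (b + k.natAbs)] with N hN
          omega
        · refine tendsto_atTop.mpr fun b => ?_
          filter_upwards [eventually_ge_atTop (b + k.natAbs)] with N hN
          omega
      rw [mul_inv_cancel₀ hQ0, one_mul] at hl
      refine hl.congr' ?_
      filter_upwards [eventually_ge_atTop k.natAbs] with N hN
      rw [if_pos (by omega)]
      obtain ⟨a, ha⟩ := Int.eq_ofNat_of_zero_le (show 0 ≤ k + N by omega)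
      obtain ⟨b, hb⟩ := Int.eq_ofNat_of_zero_le (show 0 ≤ N - k by omega)
      rw [ha, hb, show N + N = a + b by omega, Int.toNat_natCast, Int.toNat_natCast,
        gaussBinom_eq_div hq]
    · refine Eventually.of_forall fun N k => ?_
      rw [hterm, norm_mul]
      gcongr
      split_ifs
      · exact hC _ _
      · simpa using hC0
  simp only [← finite_triple_product_symm hh0 _ hy0, tsum_mul_left] at hlim2
  have hlim3 := (tendsto_qPoch hq).mul hlim2
  rw [← hQ, mul_inv_cancel_left₀ hQ0] at hlim3
  refine tendsto_nhds_unique hlim (hlim3.congr fun N => ?_)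
  rw [qPoch, Finset.prod_mul_distrib, Finset.prod_mul_distrib]
  simp only [pow_mul]
  ring

lemma neg_one_pow_eq_exp (n : ℕ) : (-1 : ℂ) ^ n = cexp (π * I * n) := by
  rw [mul_comm, Complex.exp_nat_mul, Complex.exp_pi_mul_I]

lemma neg_one_pow_eq_exp_neg (n : ℕ) : (-1 : ℂ) ^ n = cexp (-(π * I * n)) := by
  rw [Complex.exp_neg, ← neg_one_pow_eq_exp, ← inv_pow]; norm_num

theorem theta_eq_jacobiTheta₂ (ε ε' : ℕ) (u τ : ℂ) (hτ : 0 < τ.im) :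
    theta ε ε' u τ =
      e2 (u * ε / 2) * e2 (τ * ε / 8) * jacobiTheta₂ (u + ε * τ / 2 + ε' / 2) τ := by
  rw [theta, ← jacobi_triple_product _ _ hτ]
  congr 2
  funext n
  congr 1
  · congr 1
    · rw [e2, ← Complex.exp_nat_mul]; push_cast; ring_nf
    · rw [neg_one_pow_eq_exp, e2, e2, ← Complex.exp_nat_mul, ← Complex.exp_add, ← Complex.exp_add,
        ← Complex.exp_add]
      push_cast; ring_nf
  · rw [neg_one_pow_eq_exp_neg, e2, e2, ← Complex.exp_nat_mul, ← Complex.exp_add,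
      ← Complex.exp_add, ← Complex.exp_add]
    push_cast; ring_nf

/-- The square root `√(-iτ)` governing weight one half. -/
def sqrtNegI (τ : ℂ) : ℂ := (-I * τ) ^ (1 / 2 : ℂ)

lemma sqrtNegI_sq (τ : ℂ) : sqrtNegI τ ^ 2 = -I * τ := by
  rw [sqrtNegI, ← Complex.cpow_mul_nat]; simp

lemma sqrtNegI_ne_zero {τ : ℂ} (hτ : 0 < τ.im) : sqrtNegI τ ≠ 0 := by
  intro h
  have := sqrtNegI_sq τ
  rw [h] at this
  have h0 : τ = 0 := by simpa using this
  simp [h0] at hτ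

lemma jacobiTheta₂_S (z τ : ℂ) (hτ : 0 < τ.im) :
    jacobiTheta₂ (z / τ) (-1 / τ) =
      sqrtNegI τ * cexp (π * I * z ^ 2 / τ) * jacobiTheta₂ z τ := by
  rw [jacobiTheta₂_functional_equation z τ, ← sqrtNegI]
  have h0 := sqrtNegI_ne_zero hτ
  rw [neg_mul, neg_mul, neg_div τ (π * I * z ^ 2), Complex.exp_neg]
  have := Complex.exp_ne_zero (π * I * z ^ 2 / τ)
  generalize cexp (π * I * z ^ 2 / τ) = w at *
  field_simp

lemma im_neg_one_div_pos {τ : ℂ} (hτ : 0 < τ.im) : 0 < (-1 / τ).im := by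
  have h0 : τ ≠ 0 := by rintro rfl; simp at hτ
  have : 0 < normSq τ := normSq_pos.mpr h0
  rw [neg_div, one_div, neg_im, inv_im]
  simp only [neg_div, neg_neg]
  positivity

theorem theta_S (ε ε' : ℕ) (hε : ε ≤ 1) (hε' : ε' ≤ 1) (u τ : ℂ) (hτ : 0 < τ.im) :
    theta ε ε' (u / τ) (-1 / τ) =
      I ^ (-((ε : ℤ) * ε')) * sqrtNegI τ * cexp (π * I * u ^ 2 / τ) * theta ε' ε u τ := by
  have h0 : τ ≠ 0 := by rintro rfl; simp at hτ
  rw [theta_eq_jacobiTheta₂ _ _ _ _ hτ, theta_eq_jacobiTheta₂ _ _ _ _ (im_neg_one_div_pos hτ)]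
  rw [show u / τ + ε * (-1 / τ) / 2 + ε' / 2 = (u + ε' * τ / 2 - ε / 2) / τ by field_simp; ring,
    jacobiTheta₂_S _ _ hτ]
  have hper : jacobiTheta₂ (u + ε' * τ / 2 + ε / 2) τ =
      jacobiTheta₂ (u + ε' * τ / 2 - ε / 2) τ := by
    interval_cases ε
    · simp
    · rw [← jacobiTheta₂_add_left (u + ε' * τ / 2 - (1 : ℕ) / 2)]; push_cast; ring_nf
  have hε2 : (ε : ℂ) ^ 2 = ε := by interval_cases ε <;> simp
  rw [hper]
  have hI : I ^ (-((ε : ℤ) * ε')) = cexp (-(π * I * ε * ε' / 2)) := by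
    have : I = cexp (π / 2 * I) := by rw [Complex.exp_pi_div_two_mul_I]
    conv_lhs => rw [this]
    rw [← Complex.exp_int_mul]; push_cast; ring_nf
  rw [hI]
  have hε'2 : (ε' : ℂ) ^ 2 = ε' := by interval_cases ε' <;> simp
  rw [e2, e2, e2, e2]
  have key : cexp (2 * π * I * (u / τ * ε / 2)) * cexp (2 * π * I * (-1 / τ * ε / 8)) *
      cexp (π * I * (u + ε' * τ / 2 - ε / 2) ^ 2 / τ) =
      cexp (-(π * I * ε * ε' / 2)) * cexp (π * I * u ^ 2 / τ) *
      (cexp (2 * π * I * (u * ε' / 2)) * cexp (2 * π * I * (τ * ε' / 8))) := by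
    simp only [← Complex.exp_add]
    congr 1
    field_simp
    linear_combination (8 : ℂ) * hε2 + 8 * τ ^ 2 * hε'2
  linear_combination sqrtNegI τ * jacobiTheta₂ (u + ε' * τ / 2 - ε / 2) τ * key

theorem two_mul_dedekindEta_pow_three (τ : ℂ) (hτ : 0 < τ.im) :
    2 * dedekindEta τ ^ 3 = theta 0 0 0 τ * theta 0 1 0 τ * theta 1 0 0 τ := by
  set h := cexp (π * I * τ) with hh
  have hn : ‖h‖ < 1 := by
    rw [hh, Complex.norm_exp, Real.exp_lt_one_iff]
    simp
    positivity
  have hq : ‖h ^ 2‖ < 1 := by rw [norm_pow]; exact pow_lt_one₀ (norm_nonneg _) hn (by omega)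
  have hgeo := summable_geometric_of_lt_one (norm_nonneg _) hn
  have hm (c : ℂ) (f : ℕ → ℕ) (hf : f.Injective) : Multipliable fun n : ℕ => 1 + c * h ^ f n :=
    multipliable_one_add_of_summable (by
      simpa only [norm_mul, norm_pow, Function.comp_def] using (hgeo.comp_injective hf).mul_left ‖c‖)
  have hodd : (fun n : ℕ => 2 * n + 1).Injective := fun a b hab => by simp at hab; omega
  have hev : (fun n : ℕ => 2 * (n + 1)).Injective := fun a b hab => by simp at hab; omega
  have hev0 : (fun n : ℕ => 2 * n).Injective := fun a b hab => by simp at hab; omega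
  have hsucc : (fun n : ℕ => n + 1).Injective := fun a b hab => by simp at hab; omega
  set P := ∏' n : ℕ, (1 + (-1) * h ^ (2 * (n + 1))) with hP
  set A := ∏' n : ℕ, (1 + 1 * h ^ (2 * n + 1)) with hA
  set B := ∏' n : ℕ, (1 + (-1) * h ^ (2 * n + 1)) with hB
  set D := ∏' n : ℕ, (1 + 1 * h ^ (2 * (n + 1))) with hD
  have hP0 : P ≠ 0 := by
    have := tprod_one_sub_pow_ne_zero hq
    rw [hP]
    convert this using 3 with n
    rw [pow_mul]; ring
  have hsplit (c : ℂ) : (∏' n : ℕ, (1 + c * h ^ (2 * n + 1))) *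
      ∏' n : ℕ, (1 + c * h ^ (2 * (n + 1))) = ∏' n : ℕ, (1 + c * h ^ (n + 1)) :=
    tprod_even_mul_odd (f := fun n : ℕ => 1 + c * h ^ (n + 1)) (hm c _ hodd) (hm c _ hev)
  have hABD : A * B * D = 1 := by
    have e : (∏' n : ℕ, (1 + 1 * h ^ (n + 1))) * ∏' n : ℕ, (1 + (-1) * h ^ (n + 1)) = P := by
      rw [← (hm 1 _ hsucc).tprod_mul (hm (-1) _ hsucc)]
      refine tprod_congr fun n => ?_
      rw [pow_mul, pow_right_comm]; ring
    rw [← hsplit, ← hsplit, ← hA, ← hB, ← hD, ← hP] at e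
    exact mul_left_cancel₀ hP0 (by linear_combination e)
  have heta : dedekindEta τ = e2 (τ / 24) * P := by
    rw [dedekindEta, hP]
    congr 2; funext n
    rw [hh, e2, ← Complex.exp_nat_mul]; push_cast; ring_nf
  have h00 : theta 0 0 0 τ = P * A * A := by
    rw [theta, hP, hA, ← (hm (-1) _ hev).tprod_mul (hm 1 _ hodd),
      ← ((hm (-1) _ hev).mul (hm 1 _ hodd)).tprod_mul (hm 1 _ hodd)]
    simp only [hh, e2, ← Complex.exp_nat_mul]
    simp only [Nat.cast_zero, mul_zero, zero_div, Complex.exp_zero, neg_zero, pow_zero, one_mul]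
    refine tprod_congr fun n => ?_
    push_cast; ring_nf
  have h01 : theta 0 1 0 τ = P * B * B := by
    rw [theta, hP, hB, ← (hm (-1) _ hev).tprod_mul (hm (-1) _ hodd),
      ← ((hm (-1) _ hev).mul (hm (-1) _ hodd)).tprod_mul (hm (-1) _ hodd)]
    simp only [hh, e2, ← Complex.exp_nat_mul]
    simp only [Nat.cast_zero, mul_zero, zero_div, Complex.exp_zero, neg_zero, pow_one, one_mul]
    refine tprod_congr fun n => ?_
    push_cast; ring_nf
  have hshift : ∏' n : ℕ, (1 + 1 * h ^ (2 * n)) = 2 * D := by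
    have := tprod_eq_zero_mul' (f := fun n : ℕ => 1 + 1 * h ^ (2 * n)) (hm 1 _ hev)
    rw [this, ← hD, mul_zero, pow_zero]
    norm_num
  have h10 : theta 1 0 0 τ = e2 (τ / 8) * (P * D * (2 * D)) := by
    rw [theta, ← hshift, hP, hD, ← (hm (-1) _ hev).tprod_mul (hm 1 _ hev),
      ← ((hm (-1) _ hev).mul (hm 1 _ hev)).tprod_mul (hm 1 _ hev0)]
    simp only [hh, e2, ← Complex.exp_nat_mul]
    simp only [Nat.cast_one, mul_zero, mul_one, zero_div, Complex.exp_zero, neg_zero,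
      pow_zero, one_mul]
    congr 1
    refine tprod_congr fun n => ?_
    push_cast; ring_nf
  have he : e2 (τ / 24) ^ 3 = e2 (τ / 8) := by
    rw [e2, e2, ← Complex.exp_nat_mul]; push_cast; ring_nf
  rw [heta, h00, h01, h10, ← he]
  linear_combination (-2 * (e2 (τ / 24)) ^ 3 * P ^ 3) * (A * B * D + 1) * hABD

theorem dedekindEta_pow_three_S (τ : ℂ) (hτ : 0 < τ.im) :
    dedekindEta (-1 / τ) ^ 3 = sqrtNegI τ ^ 3 * dedekindEta τ ^ 3 := by
  have h1 := two_mul_dedekindEta_pow_three τ hτ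
  have h2 := two_mul_dedekindEta_pow_three _ (im_neg_one_div_pos hτ)
  have h00 := theta_S 0 0 (by simp) (by simp) 0 τ hτ
  have h01 := theta_S 0 1 (by simp) (by simp) 0 τ hτ
  have h10 := theta_S 1 0 (by simp) (by simp) 0 τ hτ
  simp at h00 h01 h10
  rw [show -1 / τ = -τ⁻¹ by ring] at *
  rw [h00, h01, h10] at h2
  linear_combination (h2 - sqrtNegI τ ^ 3 * h1) / 2

/-- The integers `2pp'n + ap' - bp` which sort `ℤ` into residue classes modulo `2pp'`. -/
lemma kac_bijective {p p' : ℤ} (hp : 2 ≤ p) (hp' : 2 ≤ p') (hco : IsCoprime p p') :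
    Function.Bijective fun x : ℤ × (Finset.Ico (-p) p ×ˢ Finset.Ico 0 p' : Finset (ℤ × ℤ)) =>
      2 * p * p' * x.1 + x.2.1.1 * p' - x.2.1.2 * p := by
  constructor
  · rintro ⟨n, ⟨⟨a, b⟩, hab⟩⟩ ⟨n', ⟨⟨a', b'⟩, hab'⟩⟩ h
    simp only [Finset.mem_product, Finset.mem_Ico] at hab hab' h
    obtain ⟨⟨h1, h2⟩, h3, h4⟩ := hab
    obtain ⟨⟨h1', h2'⟩, h3', h4'⟩ := hab'
    have hb : b = b' := by
      have hd : p' ∣ (b - b') :=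
        hco.symm.dvd_of_dvd_mul_right
          ⟨2 * p * (n - n') + (a - a'), by linear_combination -h⟩
      exact sub_eq_zero.mp (Int.eq_zero_of_abs_lt_dvd hd (by rw [abs_lt]; omega))
    subst hb
    have hk : 2 * p * (n - n') + (a - a') = 0 := by
      have : p' * (2 * p * (n - n') + (a - a')) = 0 := by linear_combination h
      exact (mul_eq_zero.mp this).resolve_left (by omega)
    have ha : a = a' :=
      sub_eq_zero.mp (Int.eq_zero_of_abs_lt_dvd (m := 2 * p)
        ⟨n' - n, by linear_combination hk⟩ (by rw [abs_lt]; omega))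
    subst ha
    have hn : n = n' := by
      have : 2 * p * (n - n') = 0 := by linear_combination hk
      exact sub_eq_zero.mp ((mul_eq_zero.mp this).resolve_left (by omega))
    subst hn
    rfl
  · intro m
    obtain ⟨u, v, huv⟩ := hco
    set b := (-m * u) % p' with hb
    have hb0 : 0 ≤ b := Int.emod_nonneg _ (by omega)
    have hb1 : b < p' := Int.emod_lt_of_pos _ (by omega)
    obtain ⟨k, hk⟩ : p' ∣ m + b * p := by
      have := Int.mul_ediv_add_emod (-m * u) p'
      rw [← hb] at this
      exact ⟨m * v - p * (-m * u / p'), by linear_combination (-m) * huv + p * this⟩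
    have hk2 := Int.mul_ediv_add_emod (k + p) (2 * p)
    have ha0 : 0 ≤ (k + p) % (2 * p) := Int.emod_nonneg _ (by omega)
    have ha1 : (k + p) % (2 * p) < 2 * p := Int.emod_lt_of_pos _ (by omega)
    refine ⟨⟨(k + p) / (2 * p), ⟨((k + p) % (2 * p) - p, b), ?_⟩⟩, ?_⟩
    · simp only [Finset.mem_product, Finset.mem_Ico]; omega
    · simp only
      linear_combination p' * hk2 - hk

lemma tsum_eq_sum_classes {p p' : ℤ} (hp : 2 ≤ p) (hp' : 2 ≤ p') (hco : IsCoprime p p')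
    {g : ℤ → ℂ} (hg : Summable g) :
    ∑' m, g m = ∑ x ∈ Finset.Ico (-p) p ×ˢ Finset.Ico 0 p',
      ∑' n : ℤ, g (2 * p * p' * n + x.1 * p' - x.2 * p) := by
  let e := Equiv.ofBijective _ (kac_bijective hp hp' hco)
  rw [← e.tsum_eq g, ← (Equiv.prodComm _ _).tsum_eq]
  have hs : Summable fun c => g (e (Equiv.prodComm _ _ c)) :=
    ((Equiv.prodComm _ _).trans e).summable_iff.mpr hg
  rw [hs.tsum_prod, tsum_fintype, Finset.univ_eq_attach]
  exact Finset.sum_attach _ (fun x : ℤ × ℤ =>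
    ∑' n : ℤ, g (2 * p * p' * n + x.1 * p' - x.2 * p))

lemma sum_Ico_neg_eq {p : ℤ} (H : ℤ → ℂ) (h0 : H 0 = 0) (hp : H (-p) = 0) :
    ∑ a ∈ Finset.Ico (-p) p, H a = ∑ a ∈ Finset.Icc 1 (p - 1), (H a + H (-a)) := by
  rw [← Finset.sum_filter_add_sum_filter_not _ (fun a => 0 < a), Finset.sum_add_distrib]
  congr 1
  · refine Finset.sum_congr ?_ fun _ _ => rfl
    ext a; simp; omega
  · have : ∑ a ∈ Finset.Icc 1 (p - 1), H (-a) = ∑ a ∈ Finset.Icc (-(p - 1)) (-1), H a := by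
      refine Finset.sum_nbij' (fun a => -a) (fun a => -a) ?_ ?_ ?_ ?_ ?_ <;> intro a ha <;>
        simp at ha ⊢ <;> omega
    rw [this]
    symm
    refine Finset.sum_subset ?_ ?_
    · intro a ha; simp at ha ⊢; omega
    · intro a ha ha'
      simp at ha ha'
      obtain rfl | rfl : a = 0 ∨ a = -p := by omega
      · exact h0
      · exact hp

/-- An even summable function on `ℤ` vanishing on the multiples of `p` and `p'` is summed
twice by the classes attached to the Kac table. -/
lemma tsum_eq_two_mul_sum_Kset {p p' : ℤ} (hp : 2 ≤ p) (hp' : 2 ≤ p') (hco : IsCoprime p p')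
    {g : ℤ → ℂ} (hg : Summable g) (heven : ∀ m, g (-m) = g m)
    (hzero : ∀ m, p ∣ m → g m = 0) (hzero' : ∀ m, p' ∣ m → g m = 0) :
    ∑' m, g m = 2 * ∑ x ∈ Kset p p',
      ((∑' n : ℤ, g (2 * p * p' * n + x.1 * p' - x.2 * p)) +
        ∑' n : ℤ, g (2 * p * p' * n + (-x.1) * p' - x.2 * p)) := by
  set G : ℤ → ℤ → ℂ := fun a b => ∑' n : ℤ, g (2 * p * p' * n + a * p' - b * p) with hG
  have hG0 (a b : ℤ) (h : p ∣ a) : G a b = 0 := by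
    obtain ⟨c, rfl⟩ := h
    simp only [hG]
    rw [tsum_congr fun n => hzero _ ⟨2 * p' * n + c * p' - b, by ring⟩, tsum_zero]
  have hG0' (a : ℤ) : G a 0 = 0 := by
    simp only [hG]
    rw [tsum_congr fun n => hzero' _ ⟨2 * p * n + a, by ring⟩, tsum_zero]
  have hsymm (a b : ℤ) : G (p - a) (p' - b) = G a b := by
    simp only [hG]
    rw [← (Equiv.neg ℤ).tsum_eq]
    refine tsum_congr fun n => ?_
    rw [← heven]; congr 1; simp; ring
  have hsymm' (a b : ℤ) : G (-(p - a)) (p' - b) = G (-a) b := by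
    simp only [hG]
    rw [← (Equiv.subLeft (1 : ℤ)).tsum_eq]
    refine tsum_congr fun n => ?_
    rw [← heven]; congr 1; simp; ring
  rw [tsum_eq_sum_classes hp hp' hco hg]
  change ∑ x ∈ Finset.Ico (-p) p ×ˢ Finset.Ico 0 p', G x.1 x.2 =
    2 * ∑ x ∈ Kset p p', (G x.1 x.2 + G (-x.1) x.2)
  have hfull : ∑ x ∈ Finset.Ico (-p) p ×ˢ Finset.Ico 0 p', G x.1 x.2 =
      ∑ x ∈ Finset.Icc 1 (p - 1) ×ˢ Finset.Icc 1 (p' - 1), (G x.1 x.2 + G (-x.1) x.2) := by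
    have hb (a : ℤ) : ∑ b ∈ Finset.Ico 0 p', G a b = ∑ b ∈ Finset.Icc 1 (p' - 1), G a b := by
      symm
      refine Finset.sum_subset ?_ ?_
      · intro b hb; simp at hb ⊢; omega
      · intro b hb hb'
        simp at hb hb'
        obtain rfl : b = 0 := by omega
        exact hG0' a
    rw [Finset.sum_product, Finset.sum_product]
    simp only [hb]
    rw [sum_Ico_neg_eq (fun a => ∑ b ∈ Finset.Icc 1 (p' - 1), G a b)]
    · simp only [Finset.sum_add_distrib]
    · exact Finset.sum_eq_zero fun b _ => hG0 _ _ (dvd_zero p)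
    · exact Finset.sum_eq_zero fun b _ => hG0 _ _ (dvd_neg.mpr dvd_rfl)
  rw [hfull, ← Finset.sum_filter_add_sum_filter_not _ (fun x : ℤ × ℤ =>
    x.1 * p' + x.2 * p ≤ p * p'), two_mul, Kset]
  congr 1
  have hstrict (a b : ℤ) (ha : 1 ≤ a) (ha' : a ≤ p - 1) : a * p' + b * p ≠ p * p' := by
    intro h
    have : p ∣ a := hco.dvd_of_dvd_mul_right ⟨p' - b, by linear_combination h⟩
    have := Int.le_of_dvd (by omega) this
    omega
  refine Finset.sum_nbij' (fun x => (p - x.1, p' - x.2)) (fun x => (p - x.1, p' - x.2))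
    ?_ ?_ ?_ ?_ ?_
  · rintro ⟨a, b⟩ h
    simp only [Finset.mem_filter, Finset.mem_product, Finset.mem_Icc, not_le] at h ⊢
    refine ⟨by omega, by nlinarith⟩
  · rintro ⟨a, b⟩ h
    simp only [Finset.mem_filter, Finset.mem_product, Finset.mem_Icc, not_le] at h ⊢
    refine ⟨by omega, ?_⟩
    have := lt_of_le_of_ne h.2 (hstrict a b (by omega) (by omega))
    nlinarith
  · intro x _; simp
  · intro x _; simp
  · intro x _; simp only [hsymm, hsymm']

lemma real_mul_cpow_half {c : ℝ} (hc : 0 < c) (z : ℂ) :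
    ((c : ℂ) * z) ^ (1 / 2 : ℂ) = (Real.sqrt c : ℂ) * z ^ (1 / 2 : ℂ) := by
  rcases eq_or_ne z 0 with rfl | hz
  · simp
  have hc' : (c : ℂ) ≠ 0 := by exact_mod_cast hc.ne'
  rw [Complex.cpow_def_of_ne_zero (mul_ne_zero hc' hz), Complex.log_ofReal_mul hc hz, add_mul,
    Complex.exp_add, Complex.cpow_def_of_ne_zero hz, Real.sqrt_eq_rpow,
    Complex.ofReal_cpow hc.le, Complex.cpow_def_of_ne_zero hc', Complex.ofReal_log hc.le]
  push_cast
  rfl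

lemma sqrtNegI_real_mul {c : ℝ} (hc : 0 < c) (τ : ℂ) :
    sqrtNegI (c * τ) = (Real.sqrt c : ℂ) * sqrtNegI τ := by
  rw [sqrtNegI, sqrtNegI, ← real_mul_cpow_half hc]; ring_nf

lemma e2_theta_term (N l : ℂ) (hN : N ≠ 0) (τ : ℂ) (n : ℤ) :
    e2 (τ * (N * ((n : ℂ) + l / (2 * N)) ^ 2)) =
      e2 (τ * l ^ 2 / (4 * N)) * jacobiTheta₂_term n (l * τ) (2 * N * τ) := by
  rw [e2, e2, jacobiTheta₂_term, ← Complex.exp_add]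
  congr 1
  field_simp
  ring

lemma im_real_mul_pos {c : ℝ} (hc : 0 < c) {τ : ℂ} (hτ : 0 < τ.im) : 0 < ((c : ℂ) * τ).im := by
  rw [Complex.im_ofReal_mul]; positivity

lemma summable_e2_theta {N : ℝ} (hN : 0 < N) (l τ : ℂ) (hτ : 0 < τ.im) :
    Summable fun n : ℤ => e2 (τ * (N * ((n : ℂ) + l / (2 * N)) ^ 2)) := by
  have hN' : (N : ℂ) ≠ 0 := by exact_mod_cast hN.ne'
  simp only [e2_theta_term _ l hN' τ]
  refine Summable.mul_left _ ((summable_jacobiTheta₂_term_iff _ _).mpr ?_)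
  have := im_real_mul_pos (show 0 < 2 * N by positivity) hτ
  push_cast at this
  exact this

lemma tsum_e2_theta {N : ℝ} (hN : 0 < N) (l τ : ℂ) :
    ∑' n : ℤ, e2 (τ * (N * ((n : ℂ) + l / (2 * N)) ^ 2)) =
      e2 (τ * l ^ 2 / (4 * N)) * jacobiTheta₂ (l * τ) (2 * N * τ) := by
  have hN' : (N : ℂ) ≠ 0 := by exact_mod_cast hN.ne'
  simp only [e2_theta_term _ l hN' τ, tsum_mul_left, jacobiTheta₂]

lemma tsum_e2_theta_S {N : ℝ} (hN : 0 < N) (l τ : ℂ) (hτ : 0 < τ.im) :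
    ∑' n : ℤ, e2 (-1 / τ * (N * ((n : ℂ) + l / (2 * N)) ^ 2)) =
      sqrtNegI τ / (Real.sqrt (2 * N) : ℂ) * jacobiTheta₂ (l / (2 * N)) (τ / (2 * N)) := by
  have hN' : (N : ℂ) ≠ 0 := by exact_mod_cast hN.ne'
  have h0 : τ ≠ 0 := by rintro rfl; simp at hτ
  have hc : 0 < (2 * N)⁻¹ := by positivity
  have hcast : (((2 * N)⁻¹ : ℝ) : ℂ) * τ = τ / (2 * N) := by push_cast; field_simp
  have him := im_real_mul_pos hc hτ
  have hs := sqrtNegI_real_mul hc τ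
  rw [hcast] at him hs
  rw [tsum_e2_theta hN, ← jacobiTheta₂_neg_left (l / (2 * N)),
    show l * (-1 / τ) = -(l / (2 * N)) / (τ / (2 * N)) by field_simp,
    show 2 * N * (-1 / τ) = -1 / (τ / (2 * N)) by field_simp, jacobiTheta₂_S _ _ him, hs,
    Real.sqrt_inv]
  have : e2 (-1 / τ * l ^ 2 / (4 * N)) * cexp (π * I * (-(l / (2 * N))) ^ 2 / (τ / (2 * N))) = 1 := by
    rw [e2, ← Complex.exp_add]
    refine (congrArg cexp ?_).trans Complex.exp_zero
    field_simp
    ring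
  push_cast
  linear_combination (sqrtNegI τ / (Real.sqrt (2 * N) : ℂ) *
    jacobiTheta₂ (-(l / (2 * N))) (τ / (2 * N))) * this

lemma hasSum_jacobiTheta₂_cos (z : ℂ) {τ : ℂ} (hτ : 0 < τ.im) :
    HasSum (fun m : ℤ => Complex.cos (2 * π * m * z) * cexp (π * I * m ^ 2 * τ))
      (jacobiTheta₂ z τ) := by
  have h := ((hasSum_jacobiTheta₂_term z hτ).add (hasSum_jacobiTheta₂_term (-z) hτ)).div_const 2
  rw [jacobiTheta₂_neg_left, add_self_div_two] at h
  convert! h using 1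
  funext m
  rw [jacobiTheta₂_term, jacobiTheta₂_term, Complex.exp_add, Complex.exp_add, Complex.cos]
  ring_nf

/-- The numerator of the Virasoro minimal-model character. -/
def bpzNum (p p' r s : ℤ) (τ : ℂ) : ℂ :=
  ∑' n : ℤ,
    (e2 (τ * ((p * p' : ℂ) * ((n : ℂ) + ((r * p' - s * p : ℤ) : ℂ) / (2 * p * p')) ^ 2)) -
     e2 (τ * ((p * p' : ℂ) * ((n : ℂ) + ((-r * p' - s * p : ℤ) : ℂ) / (2 * p * p')) ^ 2)))

/-- The even summand `sin(πmr/p) sin(πms/p') q^{m²/4pp'}` obtained by Poisson summation. -/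
def sinTerm (p p' r s : ℤ) (τ : ℂ) (m : ℤ) : ℂ :=
  Complex.sin (π * m * r / p) * Complex.sin (π * m * s / p') * e2 (τ * m ^ 2 / (4 * p * p'))

lemma hasSum_sinTerm {p p' : ℤ} (hp : 2 ≤ p) (hp' : 2 ≤ p') (r s : ℤ) {τ : ℂ} (hτ : 0 < τ.im) :
    HasSum (fun m => 2 * sinTerm p p' r s τ m)
      (jacobiTheta₂ ((r * p' - s * p : ℤ) / (2 * (p * p'))) (τ / (2 * (p * p'))) -
        jacobiTheta₂ ((-r * p' - s * p : ℤ) / (2 * (p * p'))) (τ / (2 * (p * p')))) := by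
  have h1 : (p : ℂ) ≠ 0 := by norm_cast; omega
  have h2 : (p' : ℂ) ≠ 0 := by norm_cast; omega
  have h1' : (0 : ℝ) < p := by norm_cast; omega
  have h2' : (0 : ℝ) < p' := by norm_cast; omega
  have him : 0 < (τ / (2 * (p * p'))).im := by
    have := im_real_mul_pos (show 0 < (2 * ((p : ℝ) * p'))⁻¹ by positivity) hτ
    push_cast at this
    rwa [div_eq_inv_mul]
  convert! (hasSum_jacobiTheta₂_cos ((r * p' - s * p : ℤ) / (2 * (p * p'))) him).sub
    (hasSum_jacobiTheta₂_cos ((-r * p' - s * p : ℤ) / (2 * (p * p'))) him) using 1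
  funext m
  rw [sinTerm]
  have e1 : 2 * π * m * (((r * p' - s * p : ℤ) : ℂ) / (2 * (p * p'))) =
      π * m * r / p - π * m * s / p' := by push_cast; field_simp
  have e2' : 2 * π * m * (((-r * p' - s * p : ℤ) : ℂ) / (2 * (p * p'))) =
      -(π * m * r / p + π * m * s / p') := by push_cast; field_simp; ring
  have e3 : e2 (τ * m ^ 2 / (4 * p * p')) = cexp (π * I * m ^ 2 * (τ / (2 * (p * p')))) := by
    rw [e2]; congr 1; field_simp; ring
  rw [e1, e2', e3, Complex.cos_neg, Complex.cos_sub, Complex.cos_add]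
  ring

lemma bpzNum_S_sinTerm {p p' : ℤ} (hp : 2 ≤ p) (hp' : 2 ≤ p') (r s : ℤ) {τ : ℂ} (hτ : 0 < τ.im) :
    bpzNum p p' r s (-1 / τ) = sqrtNegI τ / (Real.sqrt (2 * ((p : ℝ) * p')) : ℂ) *
      (2 * ∑' m, sinTerm p p' r s τ m) := by
  have h1' : (0 : ℝ) < p := by norm_cast; omega
  have h2' : (0 : ℝ) < p' := by norm_cast; omega
  have hN : 0 < (p : ℝ) * p' := by positivity
  have hA := fun l : ℂ => summable_e2_theta hN l _ (im_neg_one_div_pos hτ)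
  have hB := fun l : ℂ => tsum_e2_theta_S hN l _ hτ
  push_cast at hA hB
  simp only [bpzNum, mul_assoc (2 : ℂ) (p : ℂ) (p' : ℂ)]
  rw [(hA _).tsum_sub (hA _), hB, hB, ← tsum_mul_left, (hasSum_sinTerm hp hp' r s hτ).tsum_eq]
  push_cast
  ring

lemma complex_sin_add_int_mul_pi (x : ℂ) (n : ℤ) :
    Complex.sin (x + n * π) = (-1) ^ n * Complex.sin x :=
  n.cast_negOnePow ℂ ▸ Complex.sin_antiperiodic.add_int_mul_eq n

lemma complex_sin_sub_int_mul_pi (x : ℂ) (n : ℤ) :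
    Complex.sin (x - n * π) = (-1) ^ n * Complex.sin x :=
  n.cast_negOnePow ℂ ▸ Complex.sin_antiperiodic.sub_int_mul_eq n

lemma complex_sin_int_mul_pi_sub (x : ℂ) (n : ℤ) :
    Complex.sin (n * π - x) = -((-1) ^ n * Complex.sin x) := by
  simpa only [Complex.sin_neg, mul_neg, Int.cast_negOnePow] using
    Complex.sin_antiperiodic.int_mul_sub_eq n

lemma neg_one_zpow_congr {a b : ℤ} (h : Even (a - b)) : (-1 : ℂ) ^ a = (-1) ^ b := by
  rw [show a = b + (a - b) by ring, zpow_add₀ (by norm_num), h.neg_one_zpow, mul_one]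

lemma sinTerm_class {p p' : ℤ} (hp : 2 ≤ p) (hp' : 2 ≤ p') (r s a b n : ℤ) (τ : ℂ) :
    sinTerm p p' r s τ (2 * p * p' * n + a * p' - b * p) =
      -((-1) ^ (r * b + s * a) * Complex.sin (π * r * a * p' / p) *
        Complex.sin (π * s * b * p / p')) *
      e2 (τ * ((p * p' : ℂ) * ((n : ℂ) + ((a * p' - b * p : ℤ) : ℂ) / (2 * p * p')) ^ 2)) := by
  have h1 : (p : ℂ) ≠ 0 := by norm_cast; omega
  have h2 : (p' : ℂ) ≠ 0 := by norm_cast; omega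
  have e1 : (π : ℂ) * (2 * p * p' * n + a * p' - b * p : ℤ) * r / p =
      π * r * a * p' / p + (2 * p' * n * r - b * r : ℤ) * π := by
    push_cast; field_simp; ring
  have e3 : (π : ℂ) * (2 * p * p' * n + a * p' - b * p : ℤ) * s / p' =
      (2 * p * n * s + a * s : ℤ) * π - π * s * b * p / p' := by
    push_cast; field_simp
  have e4 : τ * ((2 * p * p' * n + a * p' - b * p : ℤ) : ℂ) ^ 2 / (4 * p * p') =
      τ * ((p * p' : ℂ) * ((n : ℂ) + ((a * p' - b * p : ℤ) : ℂ) / (2 * p * p')) ^ 2) := by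
    push_cast; field_simp; ring
  have hsign : (-1 : ℂ) ^ (2 * p' * n * r - b * r) * (-1) ^ (2 * p * n * s + a * s) =
      (-1) ^ (r * b + s * a) := by
    rw [← zpow_add₀ (by norm_num)]
    exact neg_one_zpow_congr ⟨p' * n * r - b * r + p * n * s, by ring⟩
  rw [sinTerm, e1, e3, e4, complex_sin_add_int_mul_pi, complex_sin_int_mul_pi_sub, ← hsign]
  ring

lemma SBPZ_eq {p p' : ℤ} (hp : 2 ≤ p) (hp' : 2 ≤ p') (r s a b : ℤ) :
    SBPZ p p' r s a b = (Real.sqrt (8 / ((p : ℝ) * p')) : ℂ) *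
      -((-1) ^ (r * b + s * a) * Complex.sin (π * r * a * p' / p) *
        Complex.sin (π * s * b * p / p')) := by
  have h1 : (p : ℂ) ≠ 0 := by norm_cast; omega
  have h2 : (p' : ℂ) ≠ 0 := by norm_cast; omega
  have e1 : (π : ℂ) * (p - p') * r * a / p = (r * a : ℤ) * π - π * r * a * p' / p := by
    push_cast; field_simp
  have e3 : (π : ℂ) * (p - p') * s * b / p' = π * s * b * p / p' - (s * b : ℤ) * π := by
    push_cast; field_simp
  have hsign : (-1 : ℂ) ^ ((r + s) * (a + b)) * ((-1) ^ (r * a) * (-1) ^ (s * b)) =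
      (-1) ^ (r * b + s * a) := by
    rw [← zpow_add₀ (by norm_num), ← zpow_add₀ (by norm_num)]
    exact neg_one_zpow_congr ⟨r * a + s * b, by ring⟩
  rw [SBPZ]
  push_cast
  rw [e1, e3, complex_sin_sub_int_mul_pi, complex_sin_int_mul_pi_sub, ← hsign]
  ring

lemma sinTerm_neg (p p' r s : ℤ) (τ : ℂ) (m : ℤ) :
    sinTerm p p' r s τ (-m) = sinTerm p p' r s τ m := by
  simp [sinTerm, neg_div]

lemma sinTerm_eq_zero_left {p : ℤ} (hp : 2 ≤ p) (p' r s : ℤ) (τ : ℂ) {m : ℤ} (h : p ∣ m) :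
    sinTerm p p' r s τ m = 0 := by
  obtain ⟨c, rfl⟩ := h
  have h1 : (p : ℂ) ≠ 0 := by norm_cast; omega
  have : (π : ℂ) * (p * c : ℤ) * r / p = (c * r : ℤ) * π := by push_cast; field_simp
  rw [sinTerm, this, Complex.sin_int_mul_pi, zero_mul, zero_mul]

lemma sinTerm_eq_zero_right {p' : ℤ} (hp' : 2 ≤ p') (p r s : ℤ) (τ : ℂ) {m : ℤ} (h : p' ∣ m) :
    sinTerm p p' r s τ m = 0 := by
  obtain ⟨c, rfl⟩ := h
  have h1 : (p' : ℂ) ≠ 0 := by norm_cast; omega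
  have : (π : ℂ) * (p' * c : ℤ) * s / p' = (c * s : ℤ) * π := by push_cast; field_simp
  rw [sinTerm, this, Complex.sin_int_mul_pi, mul_zero, zero_mul]

lemma sqrt_mul_tsum_sinTerm {p p' : ℤ} (hp : 2 ≤ p) (hp' : 2 ≤ p') (r s a b : ℤ) {τ : ℂ}
    (hτ : 0 < τ.im) :
    (Real.sqrt (8 / ((p : ℝ) * p')) : ℂ) *
      ((∑' n : ℤ, sinTerm p p' r s τ (2 * p * p' * n + a * p' - b * p)) +
        ∑' n : ℤ, sinTerm p p' r s τ (2 * p * p' * n + (-a) * p' - b * p)) =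
      SBPZ p p' r s a b * bpzNum p p' a b τ := by
  have h1' : (0 : ℝ) < p := by norm_cast; omega
  have h2' : (0 : ℝ) < p' := by norm_cast; omega
  have hA := fun l : ℂ => summable_e2_theta (show 0 < (p : ℝ) * p' by positivity) l _ hτ
  push_cast at hA
  simp only [← mul_assoc (2 : ℂ) (p : ℂ) (p' : ℂ)] at hA
  rw [SBPZ_eq hp hp', bpzNum, (hA _).tsum_sub (hA _)]
  simp only [sinTerm_class hp hp', tsum_mul_left]
  have hs : (-1 : ℂ) ^ (r * b + s * -a) = (-1) ^ (r * b + s * a) :=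
    neg_one_zpow_congr ⟨-(s * a), by ring⟩
  have hsin : Complex.sin (π * r * (-a : ℤ) * p' / p) = -Complex.sin (π * r * a * p' / p) := by
    rw [← Complex.sin_neg]; push_cast; ring_nf
  rw [hs, hsin]
  ring

theorem bpzNum_S {p p' : ℤ} (hp : 2 ≤ p) (hp' : 2 ≤ p') (hco : IsCoprime p p') (r s : ℤ) {τ : ℂ}
    (hτ : 0 < τ.im) :
    bpzNum p p' r s (-1 / τ) =
      sqrtNegI τ * ∑ x ∈ Kset p p', SBPZ p p' r s x.1 x.2 * bpzNum p p' x.1 x.2 τ := by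
  have h1' : (0 : ℝ) < p := by norm_cast; omega
  have h2' : (0 : ℝ) < p' := by norm_cast; omega
  have hN : 0 < (p : ℝ) * p' := by positivity
  have hsum : Summable (sinTerm p p' r s τ) :=
    (summable_mul_left_iff two_ne_zero).mp (hasSum_sinTerm hp hp' r s hτ).summable
  rw [bpzNum_S_sinTerm hp hp' r s hτ, tsum_eq_two_mul_sum_Kset hp hp' hco hsum
    (sinTerm_neg _ _ _ _ _) (fun m => sinTerm_eq_zero_left hp _ _ _ _)
    (fun m => sinTerm_eq_zero_right hp' _ _ _ _)]
  simp only [← sqrt_mul_tsum_sinTerm hp hp' r s _ _ hτ, ← Finset.mul_sum]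
  have hsq : Real.sqrt (8 / ((p : ℝ) * p')) = 4 / Real.sqrt (2 * ((p : ℝ) * p')) := by
    rw [show 8 / ((p : ℝ) * p') = 4 ^ 2 / (2 * ((p : ℝ) * p')) by field_simp; norm_num,
      Real.sqrt_div (by norm_num), Real.sqrt_sq (by norm_num)]
  rw [hsq]
  push_cast
  ring

/-- The integrand over `y` of a typical-typical `S`-transformation, stripped of constants. -/
def quadKernel (a X : ℂ) (c : ℂ) (u τ : ℂ) (y : ℂ) : ℂ :=
  cexp (-4 * π * I * a * X * (y - c)) * e2 (τ * (a * (y - c) ^ 2)) *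
    e2 (u * (2 * I * a * (y - c)))

lemma quadKernel_eq (a X c u τ y : ℂ) :
    quadKernel a X c u τ y = cexp ((2 * π * I * τ * a) * y ^ 2 +
      (-4 * π * I * τ * a * c - 4 * π * I * a * (X - I * u)) * y +
      (2 * π * I * τ * a * c ^ 2 + 4 * π * I * a * (X - I * u) * c)) := by
  simp only [quadKernel, e2, ← Complex.exp_add]
  congr 1
  ring

lemma re_quadratic_coeff_neg {a : ℝ} (ha : 0 < a) {τ : ℂ} (hτ : 0 < τ.im) :
    (2 * π * I * τ * a : ℂ).re < 0 := by
  have h : (2 * π * I * τ * a : ℂ).re = -(2 * π * τ.im * a) := by simp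
  rw [h, neg_lt_zero]
  have := Real.pi_pos
  positivity

lemma integrable_quadKernel {a : ℝ} (ha : 0 < a) (X c u : ℂ) {τ : ℂ} (hτ : 0 < τ.im) :
    Integrable (fun y : ℝ => quadKernel a X c u τ y) := by
  simp only [quadKernel_eq]
  exact integrable_cexp_quadratic' (re_quadratic_coeff_neg ha hτ) _ _

lemma sqrt_mul_integral_quadKernel {a : ℝ} (ha : 0 < a) (X c u : ℂ) {τ : ℂ} (hτ : 0 < τ.im) :
    (Real.sqrt (2 * a) : ℂ) * ∫ y : ℝ, quadKernel a X c u τ y =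
      (sqrtNegI τ)⁻¹ * cexp (-2 * π * I * a * (X - I * u) ^ 2 / τ) := by
  have hτ0 : τ ≠ 0 := by rintro rfl; simp at hτ
  have ha0 : (a : ℂ) ≠ 0 := by exact_mod_cast ha.ne'
  have hπ : (π : ℂ) ≠ 0 := by exact_mod_cast Real.pi_ne_zero
  simp only [quadKernel_eq]
  rw [integral_cexp_quadratic (re_quadratic_coeff_neg ha hτ)]
  have h1 : (π : ℂ) / -(2 * π * I * τ * a) = ((2 * a)⁻¹ : ℝ) * (-I * τ)⁻¹ := by
    push_cast
    field_simp
  have harg : (-I * τ).arg ≠ π := by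
    intro h
    have := Complex.arg_eq_pi_iff.mp h
    simp at this
    linarith
  rw [h1, real_mul_cpow_half (by positivity), Complex.inv_cpow _ _ harg, ← sqrtNegI,
    Real.sqrt_inv]
  have h2 : (Real.sqrt (2 * a) : ℂ) ≠ 0 := by
    exact_mod_cast (Real.sqrt_pos.mpr (by positivity : (0:ℝ) < 2 * a)).ne'
  push_cast
  rw [← mul_assoc, ← mul_assoc, mul_inv_cancel₀ h2, one_mul]
  congr 2
  field_simp
  ring

lemma Stt_mul_Tchar (p p' : ℤ) (ε ε' : ℕ) (r s : ℤ) (x : ℂ) (r' s' : ℤ) (y τ u t : ℂ) :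
    Stt p p' ε ε' r s x r' s' y * Tchar p p' ε' ε r' s' y τ u t =
      (I ^ (-((ε : ℤ) * ε')) * (-1) ^ (ε * ε') * e2 (t * (3 * (1 - 2 * ((p' : ℂ) / p)))) *
        theta ε' ε u τ * (dedekindEta τ ^ 3)⁻¹ * (Real.sqrt (2 * ((p' : ℝ) / p)) : ℂ) *
        (SBPZ p p' r s r' s' * bpzNum p p' r' s' τ)) *
      quadKernel ((p' / p : ℝ) : ℂ) (x - I * ε / 2) (I * ε' / 2) u τ y := by
  rw [Stt, Tchar, show chiBPZ p p' r' s' τ = (dedekindEta τ)⁻¹ * bpzNum p p' r' s' τ from rfl,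
    quadKernel, mul_comm ε' ε]
  push_cast
  ring

theorem Tchar_S {p p' : ℤ} (hp : 2 ≤ p) (hp' : 2 ≤ p') (hco : IsCoprime p p') (r s : ℤ) (x : ℂ)
    {ε ε' : ℕ} (hε : ε ≤ 1) (hε' : ε' ≤ 1) {τ : ℂ} (hτ : 0 < τ.im) (u t : ℂ) :
    Tchar p p' ε ε' r s x (-1 / τ) (u / τ) (t - u ^ 2 / (6 * τ)) =
      I ^ (-((ε : ℤ) * ε')) * (-1) ^ (ε * ε') * e2 (t * (3 * (1 - 2 * ((p' : ℂ) / p)))) *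
        theta ε' ε u τ * (dedekindEta τ ^ 3)⁻¹ *
        ((sqrtNegI τ)⁻¹ * cexp (-2 * π * I * (p' / p) * (x - I * ε / 2 - I * u) ^ 2 / τ)) *
        ∑ k ∈ Kset p p', SBPZ p p' r s k.1 k.2 * bpzNum p p' k.1 k.2 τ := by
  have hτ0 : τ ≠ 0 := by rintro rfl; simp at hτ
  have hs := sqrtNegI_ne_zero hτ
  have hexp : e2 (-1 / τ * (((p' : ℂ) / p) * (x - I * ε / 2) ^ 2)) *
      e2 (u / τ * (2 * I * ((p' : ℂ) / p) * (x - I * ε / 2))) *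
      e2 ((t - u ^ 2 / (6 * τ)) * (3 * (1 - 2 * ((p' : ℂ) / p)))) * cexp (π * I * u ^ 2 / τ) =
      e2 (t * (3 * (1 - 2 * ((p' : ℂ) / p)))) *
        cexp (-2 * π * I * (p' / p) * (x - I * ε / 2 - I * u) ^ 2 / τ) := by
    simp only [e2, ← Complex.exp_add]
    congr 1
    generalize (p' : ℂ) / p = a
    generalize x - I * ε / 2 = X
    field_simp
    ring_nf
    simp only [I_sq]
    ring
  calc _ = (-1) ^ (ε * ε') * (e2 (-1 / τ * (((p' : ℂ) / p) * (x - I * ε / 2) ^ 2)) *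
      e2 (u / τ * (2 * I * ((p' : ℂ) / p) * (x - I * ε / 2))) *
      e2 ((t - u ^ 2 / (6 * τ)) * (3 * (1 - 2 * ((p' : ℂ) / p))))) *
      theta ε ε' (u / τ) (-1 / τ) * (dedekindEta (-1 / τ) ^ 3)⁻¹ * bpzNum p p' r s (-1 / τ) := by
        rw [Tchar, show chiBPZ p p' r s (-1 / τ) =
          (dedekindEta (-1 / τ))⁻¹ * bpzNum p p' r s (-1 / τ) from rfl]
        ring
    _ = (-1) ^ (ε * ε') * (e2 (-1 / τ * (((p' : ℂ) / p) * (x - I * ε / 2) ^ 2)) *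
      e2 (u / τ * (2 * I * ((p' : ℂ) / p) * (x - I * ε / 2))) *
      e2 ((t - u ^ 2 / (6 * τ)) * (3 * (1 - 2 * ((p' : ℂ) / p)))) * cexp (π * I * u ^ 2 / τ)) *
      I ^ (-((ε : ℤ) * ε')) * theta ε' ε u τ * (dedekindEta τ ^ 3)⁻¹ *
      (∑ k ∈ Kset p p', SBPZ p p' r s k.1 k.2 * bpzNum p p' k.1 k.2 τ) *
      (sqrtNegI τ * sqrtNegI τ * (sqrtNegI τ ^ 3)⁻¹) := by
        rw [theta_S ε ε' hε hε' u τ hτ, dedekindEta_pow_three_S τ hτ, bpzNum_S hp hp' hco r s hτ,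
          mul_inv]
        ring
    _ = _ := by
        rw [hexp, show sqrtNegI τ * sqrtNegI τ * (sqrtNegI τ ^ 3)⁻¹ = (sqrtNegI τ)⁻¹ by
          field_simp]
        ring

/-- Modular S-transformation of the typical characters. -/
theorem typical_S_transformation (p p' : ℤ) (hp : 2 ≤ p) (hp' : 2 ≤ p')
    (hco : IsCoprime p p') (r s : ℤ) (hK : (r, s) ∈ Kset p p') (x : ℂ)
    (ε ε' : ℕ) (hε : ε ≤ 1) (hε' : ε' ≤ 1)
    (τ : ℂ) (hτ : 0 < τ.im) (u t : ℂ) :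
    (∀ r' s' : ℤ, (r', s') ∈ Kset p p' →
      Integrable (fun x' : ℝ =>
        Stt p p' ε ε' r s x r' s' (x' : ℂ) * Tchar p p' ε' ε r' s' (x' : ℂ) τ u t)) ∧
    Tchar p p' ε ε' r s x (-1 / τ) (u / τ) (t - u ^ 2 / (6 * τ)) =
      ∑ rs' ∈ Kset p p', ∫ x' : ℝ,
        Stt p p' ε ε' r s x rs'.1 rs'.2 (x' : ℂ) * Tchar p p' ε' ε rs'.1 rs'.2 (x' : ℂ) τ u t := by
  have ha : (0 : ℝ) < (p' : ℝ) / p := by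
    have h1 : (0 : ℝ) < p := by norm_cast; omega
    have h2 : (0 : ℝ) < p' := by norm_cast; omega
    positivity
  simp only [Stt_mul_Tchar]
  refine ⟨fun r' s' _ => (integrable_quadKernel ha _ _ _ hτ).const_mul _, ?_⟩
  have h := sqrt_mul_integral_quadKernel ha (x - I * ε / 2) (I * ε' / 2) u hτ
  simp only [integral_const_mul]
  rw [Tchar_S hp hp' hco r s x hε hε' hτ, Finset.mul_sum]
  push_cast at h ⊢
  rw [← h]
  exact Finset.sum_congr rfl fun k _ => by ring

end
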